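/- arXiv:1602.03537 — 2 statements merged into one kernel-verified Lean document; each statement's English description precedes it below -/
import Mathlib

section
/- Let G be a finite group and let R_G denote its nilpotent residual, i.e. the intersection of the subgroups in the lower central series of G (the smallest normal subgroup with nilpotent quotient). Suppose the quotient G/R_G has at least one proper non-trivial subgroup. Then: (1) if G/R_G is a p-group for a prime p, then γ(G) ≤ p + 1; (2) if the order of G/R_G is divisible by at least two distinct primes, then γ(G) ≤ 2. -/
/-- `D` is a dominating set of the intersection graph `Γ(G)` of the group `G`:
every member of `D` is a proper non-trivial subgroup of `G`, and every proper
non-trivial subgroup of `G` either belongs to `D` or intersects some member of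
`D` non-trivially. -/
def IsDomSet {G : Type*} [Group G] (D : Set (Subgroup G)) : Prop :=
  (∀ H ∈ D, H ≠ ⊥ ∧ H ≠ ⊤) ∧
    ∀ K : Subgroup G, K ≠ ⊥ → K ≠ ⊤ →
      K ∈ D ∨ ∃ W ∈ D, W ≠ K ∧ K ⊓ W ≠ ⊥

/-- The domination number `γ(G)`: the smallest cardinality of a dominating set
of the intersection graph `Γ(G)`. -/
noncomputable def domNumber (G : Type*) [Group G] : ℕ :=
  sInf {n : ℕ | ∃ D : Set (Subgroup G), IsDomSet D ∧ D.ncard = n}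

/-- In the intersection graph of a finite group, the family `D` of proper non-trivial subgroups is
dominating as soon as every element of prime order lies in a member of `D`. -/
theorem isDomSet_of_forall_orderOf_prime {G : Type*} [Group G] [Finite G] {D : Set (Subgroup G)}
    (hD : ∀ H ∈ D, H ≠ ⊥ ∧ H ≠ ⊤) (hx : ∀ x : G, (orderOf x).Prime → ∃ H ∈ D, x ∈ H) :
    IsDomSet D := by
  refine ⟨hD, fun K hK _ => ?_⟩
  have hcard : Nat.card K ≠ 1 := fun h => hK (Subgroup.card_eq_one.mp h)
  obtain ⟨q, hq, hqK⟩ := Nat.exists_prime_and_dvd hcard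
  have : Fact q.Prime := ⟨hq⟩
  obtain ⟨x, hxq⟩ := exists_prime_orderOf_dvd_card' (G := K) q hqK
  have hxq' : orderOf (x : G) = q := by rw [Subgroup.orderOf_coe, hxq]
  obtain ⟨H, hH, hxH⟩ := hx x (hxq' ▸ hq)
  by_cases hHK : H = K
  · exact Or.inl (hHK ▸ hH)
  · refine Or.inr ⟨H, hH, hHK, fun hbot => ?_⟩
    have hx1 : (x : G) ∈ K ⊓ H := ⟨x.2, hxH⟩
    rw [hbot, Subgroup.mem_bot] at hx1
    rw [hx1, orderOf_one] at hxq'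
    exact hq.one_lt.ne hxq'

/-- The size of any dominating set bounds the domination number. -/
theorem domNumber_le_ncard {G : Type*} [Group G] {D : Set (Subgroup G)} (hD : IsDomSet D) :
    domNumber G ≤ D.ncard :=
  Nat.sInf_le ⟨D, hD, rfl⟩

/-- A finite `p`-group has a normal subgroup of index `p ^ j` whenever `p ^ j` divides its order. -/
theorem exists_normal_index_eq_prime_pow {p : ℕ} (hp : p.Prime) (j k : ℕ) {G : Type*} [Group G]
    [Finite G] (hG : Nat.card G = p ^ (k + j)) :
    ∃ N : Subgroup G, N.Normal ∧ N.index = p ^ j := by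
  have : Fact p.Prime := ⟨hp⟩
  induction k generalizing G with
  | zero => exact ⟨⊥, inferInstance, by simpa using hG⟩
  | succ k ih =>
    have hpG : IsPGroup p G := IsPGroup.of_card hG
    have : Nontrivial G := by
      rw [← Finite.one_lt_card_iff_nontrivial, hG]
      exact Nat.one_lt_pow (by omega) hp.one_lt
    have := hpG.center_nontrivial
    obtain ⟨z, hz⟩ := exists_prime_orderOf_dvd_card' (G := Subgroup.center G) p
      ((hpG.to_subgroup _).card_eq_or_dvd.resolve_left Finite.one_lt_card.ne')
    have hle : Subgroup.zpowers (z : G) ≤ Subgroup.center G := by simp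
    have : (Subgroup.zpowers (z : G)).Normal :=
      ⟨fun n hn g => by rwa [Subgroup.mem_center_iff.mp (hle hn) g, mul_inv_cancel_right]⟩
    have hcard : Nat.card (G ⧸ Subgroup.zpowers (z : G)) = p ^ (k + j) := by
      have h := Subgroup.card_eq_card_quotient_mul_card_subgroup (Subgroup.zpowers (z : G))
      rw [Nat.card_zpowers, Subgroup.orderOf_coe, hz, hG, add_right_comm, pow_succ] at h
      exact (Nat.eq_of_mul_eq_mul_right hp.pos h).symm
    obtain ⟨N, hN, hNi⟩ := ih hcard
    exact ⟨N.comap (QuotientGroup.mk' _), inferInstance, by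
      rw [Subgroup.index_comap_of_surjective _ (QuotientGroup.mk'_surjective _), hNi]⟩

/-- A finite nilpotent group has a normal subgroup of index `p` for each prime `p` dividing its
order. -/
theorem exists_normal_index_eq_prime {G : Type*} [Group G] [Finite G] [Group.IsNilpotent G] {p : ℕ}
    (hp : p.Prime) (hpG : p ∣ Nat.card G) : ∃ N : Subgroup G, N.Normal ∧ N.index = p := by
  have : Fact p.Prime := ⟨hp⟩
  obtain ⟨e⟩ := (Group.isNilpotent_of_finite_tfae (G := G).out 0 4 rfl rfl).mp ‹_›
  let P : Sylow p G := default
  let q : (Nat.card G).primeFactors :=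
    ⟨p, Nat.mem_primeFactors.mpr ⟨hp, hpG, Nat.card_pos.ne'⟩⟩
  let f : G →* P := ((Pi.evalMonoidHom _ P).comp
    (Pi.evalMonoidHom (fun p : (Nat.card G).primeFactors => ∀ P : Sylow p G, (P : Subgroup G)) q)).comp
      e.symm.toMonoidHom
  have hf : Function.Surjective f :=
    ((Function.surjective_eval (β := fun P : Sylow p G => P) P).comp
      (Function.surjective_eval
        (β := fun p : (Nat.card G).primeFactors => ∀ P : Sylow p G, (P : Subgroup G)) q)).comp
      e.symm.surjective
  obtain ⟨n, hn⟩ := IsPGroup.iff_card.mp P.isPGroup'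
  have hn0 : n ≠ 0 := by
    rintro rfl
    have := P.dvd_card_of_dvd_card hpG
    rw [hn, pow_zero] at this
    exact hp.one_lt.ne' (Nat.dvd_one.mp this)
  obtain ⟨N, hN, hNi⟩ := exists_normal_index_eq_prime_pow hp 1 (n - 1) (G := P)
    (by rw [hn, Nat.sub_add_cancel (Nat.one_le_iff_ne_zero.mpr hn0)])
  exact ⟨N.comap f, inferInstance, by rw [Subgroup.index_comap_of_surjective _ hf, hNi, pow_one]⟩

/-- The quotient of a finite group by its nilpotent residual is nilpotent. -/
theorem isNilpotent_quotient_iInf_lowerCentralSeries {G : Type*} [Group G] [Finite G]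
    [(⨅ n, Subgroup.lowerCentralSeries (⊤ : Subgroup G) n).Normal] :
    Group.IsNilpotent (G ⧸ ⨅ n, Subgroup.lowerCentralSeries (⊤ : Subgroup G) n) := by
  obtain ⟨_, ⟨n, rfl⟩, hmin⟩ := (Set.toFinite
    (Set.range (Subgroup.lowerCentralSeries (⊤ : Subgroup G)))).exists_minimal (Set.range_nonempty _)
  refine Subgroup.nilpotent_iff_lowerCentralSeries.mpr ⟨n, ?_⟩
  rw [← Subgroup.map_top_of_surjective _ (QuotientGroup.mk'_surjective _),
    ← Subgroup.map_lowerCentralSeries, Subgroup.map_eq_bot_iff, QuotientGroup.ker_mk']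
  refine le_iInf fun m => ?_
  have hanti := Subgroup.lowerCentralSeries_antitone (S := (⊤ : Subgroup G))
  exact (hmin ⟨max n m, rfl⟩ (hanti (le_max_left n m))).trans (hanti (le_max_right n m))

/-- A group of order `p ^ 2` has at most `p + 1` subgroups of order `p`. -/
theorem ncard_setOf_card_eq_prime_le {P : Type*} [Group P] {p : ℕ} (hp : p.Prime)
    (hP : Nat.card P = p ^ 2) : {H : Subgroup P | Nat.card H = p}.ncard ≤ p + 1 := by
  have : Finite P := Nat.finite_of_card_ne_zero (by rw [hP]; exact pow_ne_zero _ hp.ne_zero)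
  let S : Set (Subgroup P) := {H | Nat.card H = p}
  change S.ncard ≤ p + 1
  have := Fintype.ofFinite S
  have hinj : Function.Injective
      (fun a : Σ H : S, {x : (H : Subgroup P) // x ≠ 1} =>
        (⟨a.2.1, fun h => a.2.2 (Subtype.ext h)⟩ : {x : P // x ≠ 1})) := by
    rintro ⟨⟨H, hH⟩, ⟨⟨x, hxH⟩, hx⟩⟩ ⟨⟨K, hK⟩, ⟨⟨y, hyK⟩, hy⟩⟩ hxy
    obtain rfl : x = y := congrArg Subtype.val hxy
    have hx1 : x ≠ 1 := fun h => hx (Subtype.ext h)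
    have key : ∀ L : Subgroup P, Nat.card L = p → x ∈ L → L = Subgroup.zpowers x := by
      intro L hL hxL
      have h := Subgroup.eq_of_le_of_card_ge (Subgroup.zpowers_le.mpr hxL) ?_
      · exact h.symm
      · have hdvd : orderOf x ∣ p := hL ▸ Subgroup.orderOf_dvd_natCard L hxL
        rw [hL, Nat.card_zpowers,
          ((Nat.dvd_prime hp).mp hdvd).resolve_left (mt orderOf_eq_one_iff.mp hx1)]
    obtain rfl : H = K := (key H hH hxH).trans (key K hK hyK).symm
    rfl
  have hcompl : ∀ (L : Type _) [Group L] [Finite L], Nat.card {x : L // x ≠ 1} = Nat.card L - 1 := by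
    intro L _ _
    classical
    have := Fintype.ofFinite L
    rw [Nat.card_eq_fintype_card, Nat.card_eq_fintype_card, Fintype.card_subtype_compl]
    simp
  have hle := Nat.card_le_card_of_injective _ hinj
  rw [Nat.card_sigma, hcompl, hP] at hle
  have hsum : ∑ H : S, Nat.card {x : (H : Subgroup P) // x ≠ 1} = S.ncard * (p - 1) := by
    have hS : ∀ H : S, Nat.card {x : (H : Subgroup P) // x ≠ 1} = p - 1 := fun H =>
      (hcompl H).trans (congrArg (· - 1) H.2)
    rw [Finset.sum_congr rfl fun H _ => hS H, Finset.sum_const, Finset.card_univ, smul_eq_mul,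
      ← Nat.card_eq_fintype_card]
    rfl
  have hsq : p ^ 2 - 1 = (p + 1) * (p - 1) := by simpa using Nat.sq_sub_sq p 1
  rw [hsum, hsq] at hle
  exact Nat.le_of_mul_le_mul_right hle (Nat.sub_pos_of_lt hp.one_lt)

/-- If `G` surjects onto a group of order `p ^ 2`, its intersection graph is dominated by the
preimages of the subgroups of order `p`. -/
theorem domNumber_le_of_surjective {G P : Type*} [Group G] [Finite G] [Group P] {p : ℕ}
    (hp : p.Prime) (hP : Nat.card P = p ^ 2) {f : G →* P} (hf : Function.Surjective f) :
    domNumber G ≤ p + 1 := by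
  have : Fact p.Prime := ⟨hp⟩
  have : Finite P := Finite.of_surjective f hf
  let S : Set (Subgroup P) := {H | Nat.card H = p}
  have hdom : IsDomSet (Subgroup.comap f '' S) := by
    refine isDomSet_of_forall_orderOf_prime ?_ fun x hx => ?_
    · rintro _ ⟨H, hH : Nat.card H = p, rfl⟩
      refine ⟨fun h => ?_, fun h => ?_⟩
      · have h1 : H = ⊥ := by
          rw [← Subgroup.map_comap_eq_self_of_surjective hf H, h, Subgroup.map_bot]
        rw [h1, Subgroup.card_bot] at hH
        exact hp.one_lt.ne hH
      · have h1 : H = ⊤ := by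
          rw [← Subgroup.map_comap_eq_self_of_surjective hf H, h, Subgroup.map_top_of_surjective f hf]
        rw [h1, Subgroup.card_top, hP] at hH
        exact (lt_self_pow₀ hp.one_lt one_lt_two).ne' hH
    · obtain ⟨H, hH, hxH⟩ : ∃ H ∈ S, f x ∈ H := by
        rcases (Nat.dvd_prime hx).mp (orderOf_map_dvd f x) with h | h
        · obtain ⟨y, hy⟩ := exists_prime_orderOf_dvd_card' (G := P) p (hP ▸ dvd_pow_self p two_ne_zero)
          refine ⟨Subgroup.zpowers y, (Nat.card_zpowers y).trans hy, ?_⟩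
          rw [orderOf_eq_one_iff.mp h]
          exact one_mem _
        · refine ⟨Subgroup.zpowers (f x), (Nat.card_zpowers _).trans ?_, Subgroup.mem_zpowers _⟩
          refine (Nat.prime_dvd_prime_iff_eq (h ▸ hx) hp).mp ((h ▸ hx).dvd_of_dvd_pow (n := 2) ?_)
          rw [← hP]
          exact orderOf_dvd_natCard _
      exact ⟨_, ⟨H, hH, rfl⟩, hxH⟩
  refine (domNumber_le_ncard hdom).trans ((Set.ncard_image_le (Set.toFinite S)).trans ?_)
  exact ncard_setOf_card_eq_prime_le hp hP

/-- If the finite group `G` has normal subgroups of distinct prime indices `p` and `q`, these two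
subgroups dominate its intersection graph. -/
theorem domNumber_le_two_of_normal_index {G : Type*} [Group G] [Finite G] {M N : Subgroup G}
    [M.Normal] [N.Normal] (hM : M.index.Prime) (hN : N.index.Prime) (hMN : M.index ≠ N.index) :
    domNumber G ≤ 2 := by
  have hprop : ∀ K L : Subgroup G, K.index.Prime → L.index.Prime → K.index ≠ L.index →
      K ≠ ⊥ ∧ K ≠ ⊤ := by
    refine fun K L hK hL hKL => ⟨?_, ?_⟩
    · rintro rfl
      have h := L.index_dvd_card
      rw [Subgroup.index_bot] at hK hKL
      exact hKL ((Nat.prime_dvd_prime_iff_eq hL hK).mp h).symm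
    · rintro rfl
      exact Nat.not_prime_one (Subgroup.index_top (G := G) ▸ hK)
  have hmem : ∀ (K : Subgroup G) [K.Normal], K.index.Prime → ∀ x : G, (orderOf x).Prime →
      orderOf x ≠ K.index → x ∈ K := by
    intro K _ hK x hx hne
    rw [← QuotientGroup.eq_one_iff, ← orderOf_eq_one_iff]
    refine Nat.eq_one_of_dvd_coprimes ((Nat.coprime_primes hx hK).mpr hne)
      (orderOf_map_dvd (QuotientGroup.mk' K) x) ?_
    exact orderOf_dvd_natCard (x : G ⧸ K)
  have hdom : IsDomSet ({M, N} : Set (Subgroup G)) := by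
    refine isDomSet_of_forall_orderOf_prime ?_ fun x hx => ?_
    · rintro H (rfl | rfl)
      exacts [hprop _ _ hM hN hMN, hprop _ _ hN hM hMN.symm]
    · by_cases h : orderOf x = M.index
      · exact ⟨N, by simp, hmem N hN x hx (h ▸ hMN)⟩
      · exact ⟨M, by simp, hmem M hM x hx h⟩
  exact (domNumber_le_ncard hdom).trans
    ((Set.ncard_insert_le M {N}).trans (by rw [Set.ncard_singleton]))

/-- Let `R` be the nilpotent residual of a finite group `G` (the intersection of
the lower central series), and suppose `G/R` has a proper non-trivial subgroup.
If `G/R` is a `p`-group then `γ(G) ≤ p + 1`; if `|G/R|` has at least two distinct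
prime divisors then `γ(G) ≤ 2`. -/
theorem nilpotent_residual_domNumber_le {G : Type*} [Group G] [Finite G]
    [hR : (⨅ n, Subgroup.lowerCentralSeries (⊤ : Subgroup G) n).Normal]
    (hQ : ∃ W : Subgroup (G ⧸ ⨅ n, Subgroup.lowerCentralSeries (⊤ : Subgroup G) n), W ≠ ⊥ ∧ W ≠ ⊤) :
    (∀ p : ℕ, p.Prime → IsPGroup p (G ⧸ ⨅ n, Subgroup.lowerCentralSeries (⊤ : Subgroup G) n) →
      domNumber G ≤ p + 1) ∧
    ((∃ p q : ℕ, p.Prime ∧ q.Prime ∧ p ≠ q ∧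
        p ∣ Nat.card (G ⧸ ⨅ n, Subgroup.lowerCentralSeries (⊤ : Subgroup G) n) ∧
        q ∣ Nat.card (G ⧸ ⨅ n, Subgroup.lowerCentralSeries (⊤ : Subgroup G) n)) →
      domNumber G ≤ 2) := by
  refine ⟨fun p hp hpQ => ?_, ?_⟩
  · have : Fact p.Prime := ⟨hp⟩
    obtain ⟨W, hWbot, hWtop⟩ := hQ
    obtain ⟨n, hn⟩ := IsPGroup.iff_card.mp hpQ
    have hn2 : 2 ≤ n := by
      by_contra! h
      have hdvd := W.card_subgroup_dvd_card
      have hn1 : n ≤ 1 := by omega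
      rw [hn] at hdvd
      rcases (Nat.dvd_prime hp).mp (hdvd.trans ((pow_dvd_pow p hn1).trans (pow_one p).dvd)) with h1 | h1
      · exact hWbot (Subgroup.card_eq_one.mp h1)
      · refine hWtop (Subgroup.eq_top_of_le_card W ?_)
        rw [hn, h1]
        exact (Nat.pow_le_pow_right hp.pos hn1).trans (pow_one p).le
    obtain ⟨N, hN, hNi⟩ := exists_normal_index_eq_prime_pow hp 2 (n - 2)
      (by rw [hn, Nat.sub_add_cancel hn2])
    exact domNumber_le_of_surjective hp hNi
      (f := (QuotientGroup.mk' N).comp (QuotientGroup.mk' _))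
      ((QuotientGroup.mk'_surjective N).comp (QuotientGroup.mk'_surjective _))
  · rintro ⟨p, q, hp, hq, hpq, hpQ, hqQ⟩
    have := isNilpotent_quotient_iInf_lowerCentralSeries (G := G)
    obtain ⟨M, hM, hMi⟩ := exists_normal_index_eq_prime hp hpQ
    obtain ⟨N, hN, hNi⟩ := exists_normal_index_eq_prime hq hqQ
    rw [← Subgroup.index_comap_of_surjective M (QuotientGroup.mk'_surjective _)] at hMi
    rw [← Subgroup.index_comap_of_surjective N (QuotientGroup.mk'_surjective _)] at hNi
    exact domNumber_le_two_of_normal_index (hMi ▸ hp) (hNi ▸ hq) (by rwa [hMi, hNi])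
end

section
/- Let G be a finite solvable group and let H, K be maximal subgroups of G whose indices |G : H| and |G : K| are coprime. Then γ(G) ≤ |G : N_G(H)| + |G : N_G(K)|, where N_G(H) and N_G(K) denote the normalizers of H and K in G. -/
open scoped Pointwise

namespace Subgroup

variable {G : Type*} [Group G]

theorem ncard_range_conj_smul (H : Subgroup G) :
    (Set.range fun g : G => MulAut.conj g • H).ncard = (normalizer (H : Set G)).index := by
  let _ : MulAction G (Subgroup G) := MulAction.compHom _ (MulAut.conj : G →* MulAut G)
  have hsmul (g : G) : g • H = MulAut.conj g • H := rfl
  have hstab : MulAction.stabilizer G H = normalizer (H : Set G) := by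
    ext g
    rw [← inv_mem_iff, MulAction.mem_stabilizer_iff, hsmul, mem_normalizer_iff, SetLike.ext_iff]
    refine forall_congr' fun x => ?_
    rw [mem_pointwise_smul_iff_inv_smul_mem]
    simp [iff_comm]
  rw [← hstab, MulAction.index_stabilizer]
  rfl

/-- A subgroup whose index is prime to `p` contains, up to conjugation, every `p`-subgroup. -/
theorem exists_le_conj_smul_of_not_dvd_index [Finite G] {p : ℕ} [Fact p.Prime]
    {H P : Subgroup G} (hH : ¬ p ∣ H.index) (hP : IsPGroup p P) :
    ∃ g : G, P ≤ MulAut.conj g • H := by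
  obtain ⟨Q, hQ⟩ := hP.exists_le_sylow
  obtain ⟨R⟩ : Nonempty (Sylow p H) := inferInstance
  have hR : ¬ p ∣ ((R : Subgroup H).map H.subtype).index := by
    rw [index_map_subtype]
    exact (Fact.out : p.Prime).not_dvd_mul R.not_dvd_index hH
  obtain ⟨g, hg⟩ := MulAction.exists_smul_eq G ((R.2.map H.subtype).toSylow hR) Q
  refine ⟨g, hQ.trans ?_⟩
  rw [← hg, Sylow.coe_subgroup_smul, IsPGroup.toSylow_coe]
  exact pointwise_smul_le_pointwise_smul_iff.2 (map_subtype_le _)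

theorem ne_bot_of_coprime_index {H K : Subgroup G} (hcop : Nat.Coprime H.index K.index)
    (hK : K ≠ ⊤) : H ≠ ⊥ := by
  rintro rfl
  rw [index_bot] at hcop
  exact hK (index_eq_one.1 (Nat.Coprime.eq_one_of_dvd hcop.symm K.index_dvd_card))

theorem conj_smul_ne_bot_and_ne_top {H : Subgroup G} (hbot : H ≠ ⊥) (htop : H ≠ ⊤) (g : G) :
    MulAut.conj g • H ≠ ⊥ ∧ MulAut.conj g • H ≠ ⊤ := by
  constructor
  · rwa [Ne, smul_eq_iff_eq_inv_smul, smul_bot]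
  · rw [Ne, smul_eq_iff_eq_inv_smul]
    refine fun h => htop (h.trans ((eq_top_iff' _).2 fun x => ?_))
    rw [mem_pointwise_smul_iff_inv_smul_mem]
    exact mem_top _

end Subgroup

open Subgroup in
theorem isDomSet_range_conj_smul_union {G : Type*} [Group G] [Finite G] {H K : Subgroup G}
    (hH : H ≠ ⊤) (hK : K ≠ ⊤) (hcop : Nat.Coprime H.index K.index) :
    IsDomSet ((Set.range fun g : G => MulAut.conj g • H) ∪
      Set.range fun g : G => MulAut.conj g • K) := by
  constructor
  · rintro _ (⟨g, rfl⟩ | ⟨g, rfl⟩)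
    · exact conj_smul_ne_bot_and_ne_top (ne_bot_of_coprime_index hcop hK) hH g
    · exact conj_smul_ne_bot_and_ne_top (ne_bot_of_coprime_index hcop.symm hH) hK g
  · intro L hL _
    obtain ⟨p, hp, hpL⟩ := Nat.exists_prime_and_dvd (mt Subgroup.card_eq_one.1 hL)
    have : Fact p.Prime := ⟨hp⟩
    obtain ⟨x, hx⟩ := exists_prime_orderOf_dvd_card' p hpL
    have hxp : orderOf (x : G) = p := by rw [Subgroup.orderOf_coe, hx]
    have hx1 : (x : G) ≠ 1 := fun h => hp.ne_one (by rw [← hxp, h, orderOf_one])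
    have hP : IsPGroup p (zpowers (x : G)) :=
      IsPGroup.of_card (n := 1) (by rw [Nat.card_zpowers, hxp, pow_one])
    obtain ⟨W, hW, hxW⟩ : ∃ W ∈ (Set.range fun g : G => MulAut.conj g • H) ∪
        Set.range fun g : G => MulAut.conj g • K, (x : G) ∈ W := by
      by_cases hpH : p ∣ H.index
      · have hpK : ¬ p ∣ K.index := fun h => Nat.not_coprime_of_dvd_of_dvd hp.one_lt hpH h hcop
        obtain ⟨g, hg⟩ := exists_le_conj_smul_of_not_dvd_index hpK hP
        exact ⟨_, Or.inr ⟨g, rfl⟩, hg (mem_zpowers _)⟩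
      · obtain ⟨g, hg⟩ := exists_le_conj_smul_of_not_dvd_index hpH hP
        exact ⟨_, Or.inl ⟨g, rfl⟩, hg (mem_zpowers _)⟩
    by_cases hWL : W = L
    · exact Or.inl (hWL ▸ hW)
    · exact Or.inr ⟨W, hW, hWL, fun h => hx1 ((eq_bot_iff_forall _).1 h x ⟨x.2, hxW⟩)⟩

/-- If `H` and `K` are maximal subgroups of a finite solvable group `G` with
coprime indices, then `γ(G) ≤ |G : N_G(H)| + |G : N_G(K)|`. -/
theorem solvable_domNumber_le {G : Type*} [Group G] [Finite G] [Group.IsSolvable G]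
    (H K : Subgroup G) (hH : IsCoatom H) (hK : IsCoatom K)
    (hcop : Nat.Coprime H.index K.index) :
    domNumber G ≤ (Subgroup.normalizer (H : Set G)).index + (Subgroup.normalizer (K : Set G)).index := by
  rw [← Subgroup.ncard_range_conj_smul, ← Subgroup.ncard_range_conj_smul]
  exact le_trans (Nat.sInf_le ⟨_, isDomSet_range_conj_smul_union hH.1 hK.1 hcop, rfl⟩)
    (Set.ncard_union_le _ _)
end
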